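/- DAMI(2,2)(2) is a dual-affine invariant of 2D vector fields: with central moments u_{pqrs} of the object (Ω, f) and u*_{pqrs} of the transformed object (Ω*, f*) under any unimodular dual-affine transformation (A_M, A_N ∈ SL(2,ℝ), translations b, c ∈ ℝ²), one has u*_{0301}·u*_{3010} − u*_{0310}·u*_{3001} − 3·u*_{1201}·u*_{2110} + 3·u*_{1210}·u*_{2101} = u_{0301}·u_{3010} − u_{0310}·u_{3001} − 3·u_{1201}·u_{2110} + 3·u_{1210}·u_{2101}. -/

import Mathlib

open MeasureTheory

/-- Centroid `(x̄, ȳ) = V⁻¹ ∫_Ω (x,y) dxdy` of a bounded set `Ω ⊂ ℝ²`. -/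
noncomputable def centroid2 (Ω : Set (Fin 2 → ℝ)) : Fin 2 → ℝ :=
  (volume Ω).toReal⁻¹ • ∫ x in Ω, x

/-- Mean `(f̄₁, f̄₂) = V⁻¹ ∫_Ω f dxdy` of a 2D vector field over `Ω`. -/
noncomputable def meanField2 (Ω : Set (Fin 2 → ℝ))
    (f : (Fin 2 → ℝ) → (Fin 2 → ℝ)) : Fin 2 → ℝ :=
  (volume Ω).toReal⁻¹ • ∫ x in Ω, f x

/-- Central moment
`u_{pqrs} = ∫_Ω (x − x̄)^p (y − ȳ)^q (f₁ − f̄₁)^r (f₂ − f̄₂)^s dxdy`. -/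
noncomputable def u (Ω : Set (Fin 2 → ℝ)) (f : (Fin 2 → ℝ) → (Fin 2 → ℝ))
    (p q r s : ℕ) : ℝ :=
  ∫ x in Ω, (x 0 - centroid2 Ω 0) ^ p * (x 1 - centroid2 Ω 1) ^ q *
    (f x 0 - meanField2 Ω f 0) ^ r * (f x 1 - meanField2 Ω f 1) ^ s

/-- The transformed domain `Ω* = {A_M x + b : x ∈ Ω}`. -/
def domStar (A_M : Matrix.SpecialLinearGroup (Fin 2) ℝ) (b : Fin 2 → ℝ)
    (Ω : Set (Fin 2 → ℝ)) : Set (Fin 2 → ℝ) :=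
  (fun x => (A_M : Matrix (Fin 2) (Fin 2) ℝ).mulVec x + b) '' Ω

/-- The transformed vector field `f*(x) = A_N·f(A_M⁻¹(x − b)) + c`. -/
noncomputable def fieldStar (A_M A_N : Matrix.SpecialLinearGroup (Fin 2) ℝ)
    (b c : Fin 2 → ℝ) (f : (Fin 2 → ℝ) → (Fin 2 → ℝ)) :
    (Fin 2 → ℝ) → (Fin 2 → ℝ) :=
  fun x => (A_N : Matrix (Fin 2) (Fin 2) ℝ).mulVec
      (f ((A_M⁻¹ : Matrix.SpecialLinearGroup (Fin 2) ℝ).1.mulVec (x - b))) + c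

theorem setIntegral_domStar {E : Type*} [NormedAddCommGroup E] [NormedSpace ℝ E]
    {Ω : Set (Fin 2 → ℝ)} (hΩm : MeasurableSet Ω)
    (A : Matrix.SpecialLinearGroup (Fin 2) ℝ) (b : Fin 2 → ℝ) (g : (Fin 2 → ℝ) → E) :
    ∫ x in domStar A b Ω, g x = ∫ x in Ω, g (A.1.mulVec x + b) := by
  have hinj : Function.Injective fun x => A.1.mulVec x + b := fun x y h =>
    Matrix.mulVec_injective_of_isUnit
      ((Matrix.isUnit_iff_isUnit_det _).2 (by simp)) (add_right_cancel h)
  have hderiv : ∀ x ∈ Ω, HasFDerivWithinAt (fun x => A.1.mulVec x + b)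
      (Matrix.toLin' A.1).toContinuousLinearMap Ω x := fun x _ =>
    ((Matrix.toLin' A.1).toContinuousLinearMap.hasFDerivAt.add_const b).hasFDerivWithinAt
  have hdet : (Matrix.toLin' A.1).toContinuousLinearMap.det = 1 := by
    rw [LinearMap.det_toContinuousLinearMap, LinearMap.det_toLin', A.2]
  rw [domStar, integral_image_eq_integral_abs_det_fderiv_smul volume hΩm hderiv hinj.injOn]
  simp [hdet]

theorem toReal_volume_domStar {Ω : Set (Fin 2 → ℝ)} (hΩm : MeasurableSet Ω)
    (A : Matrix.SpecialLinearGroup (Fin 2) ℝ) (b : Fin 2 → ℝ) :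
    (volume (domStar A b Ω)).toReal = (volume Ω).toReal := by
  simpa [Measure.real] using setIntegral_domStar hΩm A b fun _ => (1 : ℝ)

theorem fieldStar_apply_image (A N : Matrix.SpecialLinearGroup (Fin 2) ℝ)
    (b c : Fin 2 → ℝ) (f : (Fin 2 → ℝ) → (Fin 2 → ℝ)) (x : Fin 2 → ℝ) :
    fieldStar A N b c f (A.1.mulVec x + b) = N.1.mulVec (f x) + c := by
  have h : (A⁻¹).1 * A.1 = 1 := by
    rw [← Matrix.SpecialLinearGroup.coe_mul, inv_mul_cancel, Matrix.SpecialLinearGroup.coe_one]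
  simp only [fieldStar, add_sub_cancel_right, Matrix.mulVec_mulVec, h, Matrix.one_mulVec]

/-- The average of an affine image of an integrable vector field. -/
theorem average_mulVec_add {Ω : Set (Fin 2 → ℝ)} (hV : 0 < (volume Ω).toReal)
    {g : (Fin 2 → ℝ) → (Fin 2 → ℝ)} (hg : IntegrableOn g Ω)
    (N : Matrix (Fin 2) (Fin 2) ℝ) (c : Fin 2 → ℝ) :
    (volume Ω).toReal⁻¹ • ∫ x in Ω, (N.mulVec (g x) + c) =
      N.mulVec ((volume Ω).toReal⁻¹ • ∫ x in Ω, g x) + c := by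
  have hfin : volume Ω ≠ ⊤ := (ENNReal.toReal_pos_iff.1 hV).2.ne
  have hL : ∀ v, N.mulVec v = (Matrix.toLin' N).toContinuousLinearMap v := fun _ => rfl
  have hconst : IntegrableOn (fun _ : Fin 2 → ℝ => c) Ω := integrableOn_const hfin
  simp only [hL]
  rw [integral_add (ContinuousLinearMap.integrable_comp _ hg) hconst,
    ContinuousLinearMap.integral_comp_comm _ hg, setIntegral_const, smul_add, map_smul,
    smul_smul, Measure.real, inv_mul_cancel₀ hV.ne', one_smul]

theorem integrableOn_of_measurable_of_norm_le {E : Type*} [NormedAddCommGroup E]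
    [MeasurableSpace E] [BorelSpace E] [SecondCountableTopology E]
    {Ω : Set (Fin 2 → ℝ)} (hΩm : MeasurableSet Ω)
    (hfin : volume Ω ≠ ⊤) {g : (Fin 2 → ℝ) → E} (hg : Measurable g)
    (hb : ∃ C : ℝ, ∀ x ∈ Ω, ‖g x‖ ≤ C) : IntegrableOn g Ω := by
  obtain ⟨C, hC⟩ := hb
  exact Measure.integrableOn_of_bounded hfin hg.aestronglyMeasurable
    ((ae_restrict_iff' hΩm).2 (.of_forall hC))

theorem exists_bound_coord_sub {Ω : Set (Fin 2 → ℝ)} {g : (Fin 2 → ℝ) → (Fin 2 → ℝ)}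
    (hb : ∃ C : ℝ, ∀ x ∈ Ω, ‖g x‖ ≤ C) (i : Fin 2) (a : ℝ) :
    ∃ C : ℝ, 0 ≤ C ∧ ∀ x ∈ Ω, |g x i - a| ≤ C := by
  obtain ⟨C, hC⟩ := hb
  refine ⟨|C| + |a|, by positivity, fun x hx => (abs_sub _ _).trans (add_le_add ?_ le_rfl)⟩
  exact (norm_le_pi_norm (g x) i).trans ((hC x hx).trans (le_abs_self C))

theorem integrableOn_centralMoment {Ω : Set (Fin 2 → ℝ)} (hΩm : MeasurableSet Ω)
    (hΩb : Bornology.IsBounded Ω) (hfin : volume Ω ≠ ⊤)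
    {f : (Fin 2 → ℝ) → (Fin 2 → ℝ)} (hfm : Measurable f)
    (hfb : ∃ C : ℝ, ∀ x, ‖f x‖ ≤ C) (m k : Fin 2 → ℝ) (p q r s : ℕ) :
    IntegrableOn (fun x => (x 0 - m 0) ^ p * (x 1 - m 1) ^ q *
      (f x 0 - k 0) ^ r * (f x 1 - k 1) ^ s) Ω := by
  have hf : ∃ C : ℝ, ∀ x ∈ Ω, ‖f x‖ ≤ C := hfb.imp fun _ h x _ => h x
  have hx : ∃ C : ℝ, ∀ x ∈ Ω, ‖id x‖ ≤ C := hΩb.exists_norm_le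
  obtain ⟨C₀, C₀_nonneg, h₀⟩ := exists_bound_coord_sub hx 0 (m 0)
  obtain ⟨C₁, C₁_nonneg, h₁⟩ := exists_bound_coord_sub hx 1 (m 1)
  obtain ⟨D₀, D₀_nonneg, k₀⟩ := exists_bound_coord_sub hf 0 (k 0)
  obtain ⟨D₁, D₁_nonneg, k₁⟩ := exists_bound_coord_sub hf 1 (k 1)
  refine integrableOn_of_measurable_of_norm_le hΩm hfin (by fun_prop)
    ⟨C₀ ^ p * C₁ ^ q * D₀ ^ r * D₁ ^ s, fun x hx => ?_⟩
  simp only [norm_mul, norm_pow, Real.norm_eq_abs]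
  gcongr
  exacts [h₀ x hx, h₁ x hx, k₀ x hx, k₁ x hx]

/-- Central moments of the transformed object as integrals over the original domain. -/
theorem u_domStar_fieldStar {Ω : Set (Fin 2 → ℝ)}
    (hΩm : MeasurableSet Ω) (hV : 0 < (volume Ω).toReal)
    {f : (Fin 2 → ℝ) → (Fin 2 → ℝ)}
    (hid : IntegrableOn (fun x : Fin 2 → ℝ => x) Ω) (hf : IntegrableOn f Ω)
    (A N : Matrix.SpecialLinearGroup (Fin 2) ℝ) (b c : Fin 2 → ℝ) (p q r s : ℕ) :
    u (domStar A b Ω) (fieldStar A N b c f) p q r s =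
      ∫ x in Ω,
        (A.1 0 0 * (x 0 - centroid2 Ω 0) + A.1 0 1 * (x 1 - centroid2 Ω 1)) ^ p *
        (A.1 1 0 * (x 0 - centroid2 Ω 0) + A.1 1 1 * (x 1 - centroid2 Ω 1)) ^ q *
        (N.1 0 0 * (f x 0 - meanField2 Ω f 0) + N.1 0 1 * (f x 1 - meanField2 Ω f 1)) ^ r *
        (N.1 1 0 * (f x 0 - meanField2 Ω f 0) + N.1 1 1 * (f x 1 - meanField2 Ω f 1)) ^ s := by
  have hc : centroid2 (domStar A b Ω) = A.1.mulVec (centroid2 Ω) + b := by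
    rw [centroid2, toReal_volume_domStar hΩm, setIntegral_domStar hΩm,
      average_mulVec_add hV hid, centroid2]
  have hm : meanField2 (domStar A b Ω) (fieldStar A N b c f) =
      N.1.mulVec (meanField2 Ω f) + c := by
    rw [meanField2, toReal_volume_domStar hΩm, setIntegral_domStar hΩm]
    simp only [fieldStar_apply_image]
    rw [average_mulVec_add hV hf, meanField2]
  rw [u, setIntegral_domStar hΩm]
  simp only [hc, hm, fieldStar_apply_image]
  refine integral_congr_ae (.of_forall fun x => ?_)
  simp only [Pi.add_apply, Matrix.mulVec, dotProduct, Fin.sum_univ_two]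
  congr 1
  · congr 1
    · congr 1 <;> ring
    · ring
  · ring

/-- A form that is cubic in position and linear in the field integrates to a combination of
central moments. -/
theorem integral_cubic_linear {Ω : Set (Fin 2 → ℝ)} {f : (Fin 2 → ℝ) → (Fin 2 → ℝ)}
    (hint : ∀ p q r s : ℕ, IntegrableOn (fun x => (x 0 - centroid2 Ω 0) ^ p *
      (x 1 - centroid2 Ω 1) ^ q * (f x 0 - meanField2 Ω f 0) ^ r *
      (f x 1 - meanField2 Ω f 1) ^ s) Ω)
    (w : Fin 4 → ℝ) (κ ν : ℝ) {g : (Fin 2 → ℝ) → ℝ}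
    (hg : ∀ x, g x =
      (w 0 * (x 0 - centroid2 Ω 0) ^ 3 +
        w 1 * ((x 0 - centroid2 Ω 0) ^ 2 * (x 1 - centroid2 Ω 1)) +
        w 2 * ((x 0 - centroid2 Ω 0) * (x 1 - centroid2 Ω 1) ^ 2) +
        w 3 * (x 1 - centroid2 Ω 1) ^ 3) *
      (κ * (f x 0 - meanField2 Ω f 0) + ν * (f x 1 - meanField2 Ω f 1))) :
    ∫ x in Ω, g x =
      κ * (w 0 * u Ω f 3 0 1 0 + w 1 * u Ω f 2 1 1 0 + w 2 * u Ω f 1 2 1 0 +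
        w 3 * u Ω f 0 3 1 0) +
      ν * (w 0 * u Ω f 3 0 0 1 + w 1 * u Ω f 2 1 0 1 + w 2 * u Ω f 1 2 0 1 +
        w 3 * u Ω f 0 3 0 1) := by
  have key : ∀ r s : ℕ, ∫ x in Ω, (∑ i : Fin 4, w i * ((x 0 - centroid2 Ω 0) ^ (3 - i.1) *
      (x 1 - centroid2 Ω 1) ^ i.1 * (f x 0 - meanField2 Ω f 0) ^ r *
      (f x 1 - meanField2 Ω f 1) ^ s)) = ∑ i : Fin 4, w i * u Ω f (3 - i.1) i.1 r s := by
    intro r s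
    rw [integral_finsetSum _ fun i _ => (hint _ _ _ _).const_mul _]
    simp only [integral_const_mul, u]
  have hsum : ∀ r s : ℕ, IntegrableOn (fun x => ∑ i : Fin 4, w i *
      ((x 0 - centroid2 Ω 0) ^ (3 - i.1) * (x 1 - centroid2 Ω 1) ^ i.1 *
      (f x 0 - meanField2 Ω f 0) ^ r * (f x 1 - meanField2 Ω f 1) ^ s)) Ω := fun r s =>
    integrable_finsetSum _ fun i _ => (hint _ _ _ _).const_mul _
  have hu : ∀ r s : ℕ, ∑ i : Fin 4, w i * u Ω f (3 - i.1) i.1 r s =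
      w 0 * u Ω f 3 0 r s + w 1 * u Ω f 2 1 r s + w 2 * u Ω f 1 2 r s + w 3 * u Ω f 0 3 r s :=
    fun r s => Fin.sum_univ_four _
  rw [← hu, ← hu, ← key, ← key, ← integral_const_mul, ← integral_const_mul,
    ← integral_add ((hsum _ _).const_mul _) ((hsum _ _).const_mul _)]
  refine integral_congr_ae (.of_forall fun x => ?_)
  simp only [hg, Fin.sum_univ_four, Fin.coe_ofNat_eq_mod, Nat.reduceMod,
    Nat.sub_zero, Nat.sub_self, Nat.reduceSub]
  ring

/-- DAMI(2,2)(two) is a dual-affine invariant of 2D vector fields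
under any unimodular dual-affine transformation. -/
theorem dami22_two (Ω : Set (Fin 2 → ℝ))
    (hΩm : MeasurableSet Ω) (hΩb : Bornology.IsBounded Ω)
    (hV : 0 < (volume Ω).toReal)
    (f : (Fin 2 → ℝ) → (Fin 2 → ℝ)) (hfm : Measurable f)
    (hfb : ∃ C : ℝ, ∀ x, ‖f x‖ ≤ C)
    (A_M A_N : Matrix.SpecialLinearGroup (Fin 2) ℝ) (b c : Fin 2 → ℝ) :
    (let v := u (domStar A_M b Ω) (fieldStar A_M A_N b c f);
      v 0 3 0 1 * v 3 0 1 0 - v 0 3 1 0 * v 3 0 0 1 -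
        3 * v 1 2 0 1 * v 2 1 1 0 + 3 * v 1 2 1 0 * v 2 1 0 1)
      =
    (let v := u Ω f;
      v 0 3 0 1 * v 3 0 1 0 - v 0 3 1 0 * v 3 0 0 1 -
        3 * v 1 2 0 1 * v 2 1 1 0 + 3 * v 1 2 1 0 * v 2 1 0 1) := by
  have hfin : volume Ω ≠ ⊤ := (ENNReal.toReal_pos_iff.1 hV).2.ne
  have hid : IntegrableOn (fun x : Fin 2 → ℝ => x) Ω :=
    integrableOn_of_measurable_of_norm_le hΩm hfin measurable_id hΩb.exists_norm_le
  have hf : IntegrableOn f Ω :=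
    integrableOn_of_measurable_of_norm_le hΩm hfin hfm (hfb.imp fun _ h x _ => h x)
  have hint := integrableOn_centralMoment hΩm hΩb hfin hfm hfb (centroid2 Ω) (meanField2 Ω f)
  have hM : A_M.1 0 0 * A_M.1 1 1 - A_M.1 0 1 * A_M.1 1 0 = 1 := by
    rw [← Matrix.det_fin_two, A_M.2]
  have hN : A_N.1 0 0 * A_N.1 1 1 - A_N.1 0 1 * A_N.1 1 0 = 1 := by
    rw [← Matrix.det_fin_two, A_N.2]
  simp only [u_domStar_fieldStar hΩm hV hid hf]
  generalize A_M.1 0 0 = a at hM ⊢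
  generalize A_M.1 0 1 = b at hM ⊢
  generalize A_M.1 1 0 = c at hM ⊢
  generalize A_M.1 1 1 = d at hM ⊢
  generalize A_N.1 0 0 = n₀ at hN ⊢
  generalize A_N.1 0 1 = n₁ at hN ⊢
  generalize A_N.1 1 0 = n₂ at hN ⊢
  generalize A_N.1 1 1 = n₃ at hN ⊢
  rw [integral_cubic_linear hint ![c ^ 3, 3 * c ^ 2 * d, 3 * c * d ^ 2, d ^ 3] n₂ n₃
      (fun x => by simp only [Matrix.cons_val]; ring),
    integral_cubic_linear hint ![a ^ 3, 3 * a ^ 2 * b, 3 * a * b ^ 2, b ^ 3] n₀ n₁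
      (fun x => by simp only [Matrix.cons_val]; ring),
    integral_cubic_linear hint ![c ^ 3, 3 * c ^ 2 * d, 3 * c * d ^ 2, d ^ 3] n₀ n₁
      (fun x => by simp only [Matrix.cons_val]; ring),
    integral_cubic_linear hint ![a ^ 3, 3 * a ^ 2 * b, 3 * a * b ^ 2, b ^ 3] n₂ n₃
      (fun x => by simp only [Matrix.cons_val]; ring),
    integral_cubic_linear hint ![a * c ^ 2, b * c ^ 2 + 2 * a * c * d, 2 * b * c * d + a * d ^ 2, b * d ^ 2] n₂ n₃
      (fun x => by simp only [Matrix.cons_val]; ring),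
    integral_cubic_linear hint ![a ^ 2 * c, a ^ 2 * d + 2 * a * b * c, 2 * a * b * d + b ^ 2 * c, b ^ 2 * d] n₀ n₁
      (fun x => by simp only [Matrix.cons_val]; ring),
    integral_cubic_linear hint ![a * c ^ 2, b * c ^ 2 + 2 * a * c * d, 2 * b * c * d + a * d ^ 2, b * d ^ 2] n₀ n₁
      (fun x => by simp only [Matrix.cons_val]; ring),
    integral_cubic_linear hint ![a ^ 2 * c, a ^ 2 * d + 2 * a * b * c, 2 * a * b * d + b ^ 2 * c, b ^ 2 * d] n₂ n₃
      (fun x => by simp only [Matrix.cons_val]; ring)]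
  have hdet : (a * d - b * c) ^ 3 * (n₀ * n₃ - n₁ * n₂) = 1 := by simp [hM, hN]
  simp only [Matrix.cons_val]
  linear_combination (u Ω f 0 3 0 1 * u Ω f 3 0 1 0 - u Ω f 0 3 1 0 * u Ω f 3 0 0 1 -
    3 * u Ω f 1 2 0 1 * u Ω f 2 1 1 0 + 3 * u Ω f 1 2 1 0 * u Ω f 2 1 0 1) * hdet
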